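/- Let n ≥ 1 be an integer, q₀ ∈ ℝ, and φ₀ > 0. Then ∫_{0}^{φ₀} dφ/F_n(φ) = +∞, and, setting q_b = q₀ + ∫_{φ₀}^{∞} dφ/F_n(φ) ∈ (q₀, +∞], there exists a unique differentiable function φ : (−∞, q_b) → (0,∞) with φ(q₀) = φ₀ and φ'(q) = F_n(φ(q)) for all q < q_b; moreover φ is strictly increasing, φ(q) → 0 as q → −∞, and φ(q) → ∞ as q → q_b. -/

import Mathlib

open MeasureTheory Filter Set ENNReal

/-- `Fn n φ = (2·(−1)^(n+1)·(n+1)!/φ)·(∑_{k=0}^{n+1} (−1)^k φ^k/k! − e^{−φ})`. -/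
noncomputable def Fn (n : ℕ) (φ : ℝ) : ℝ :=
  2 * (-1 : ℝ) ^ (n + 1) * (Nat.factorial (n + 1)) / φ *
    ((∑ k ∈ Finset.range (n + 2), (-1 : ℝ) ^ k * φ ^ k / (Nat.factorial k)) - Real.exp (-φ))

/-- `qb n q₀ φ₀ = q₀ + ∫_{φ₀}^{∞} dφ/Fn n φ`, as an extended real number (it may be `+∞`). -/
noncomputable def qb (n : ℕ) (q₀ φ₀ : ℝ) : EReal :=
  (q₀ : EReal) + ((∫⁻ φ in Set.Ioi φ₀, ENNReal.ofReal (1 / Fn n φ) : ℝ≥0∞) : EReal)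

/-- The absolute value of the order `m` Taylor remainder of `exp (-x)` at `0`, for `x ≥ 0`. -/
noncomputable def expNegRemainder (m : ℕ) (x : ℝ) : ℝ :=
  (-1 : ℝ) ^ m *
    ((∑ k ∈ Finset.range (m + 1), (-1 : ℝ) ^ k * x ^ k / (Nat.factorial k)) - Real.exp (-x))

theorem expNegRemainder_zero_right (m : ℕ) : expNegRemainder m 0 = 0 := by
  simp [expNegRemainder, Finset.sum_range_succ']

theorem hasDerivAt_expNegRemainder_succ (m : ℕ) (x : ℝ) :
    HasDerivAt (expNegRemainder (m + 1)) (expNegRemainder m x) x := by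
  have hsum : HasDerivAt
      (fun y : ℝ => ∑ k ∈ Finset.range (m + 2), (-1 : ℝ) ^ k * y ^ k / (Nat.factorial k))
      (∑ k ∈ Finset.range (m + 2), (-1 : ℝ) ^ k * (k * x ^ (k - 1)) / (Nat.factorial k)) x :=
    HasDerivAt.fun_sum fun k _ => ((hasDerivAt_pow k x).const_mul _).div_const _
  have hexp : HasDerivAt (fun y : ℝ => Real.exp (-y)) (-Real.exp (-x)) x := by
    simpa using (hasDerivAt_neg x).exp
  refine ((hsum.sub hexp).const_mul ((-1 : ℝ) ^ (m + 1))).congr_deriv ?_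
  have hshift : ∑ k ∈ Finset.range (m + 2),
        (-1 : ℝ) ^ k * (k * x ^ (k - 1)) / (Nat.factorial k) =
      -∑ k ∈ Finset.range (m + 1), (-1 : ℝ) ^ k * x ^ k / (Nat.factorial k) := by
    rw [Finset.sum_range_succ', ← Finset.sum_neg_distrib]
    simp only [CharP.cast_eq_zero, zero_mul, mul_zero, zero_div, add_zero]
    refine Finset.sum_congr rfl fun k _ => ?_
    rw [Nat.factorial_succ, Nat.add_sub_cancel]
    push_cast
    field_simp
    ring
  rw [hshift, expNegRemainder]
  ring

theorem expNegRemainder_bounds (m : ℕ) :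
    ∀ x : ℝ, 0 < x →
      0 < expNegRemainder m x ∧ expNegRemainder m x ≤ x ^ (m + 1) / (Nat.factorial (m + 1)) := by
  induction m with
  | zero =>
    intro x hx
    have h₁ : Real.exp (-x) < 1 := Real.exp_lt_one_iff.2 (by linarith)
    have h₂ := Real.add_one_le_exp (-x)
    simp only [expNegRemainder]
    norm_num
    exact ⟨hx, by linarith⟩
  | succ m ih =>
    intro x hx
    have hcont : Continuous (expNegRemainder (m + 1)) :=
      continuous_iff_continuousAt.2 fun y => (hasDerivAt_expNegRemainder_succ m y).continuousAt
    constructor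
    · have hmono : StrictMonoOn (expNegRemainder (m + 1)) (Ici 0) := by
        refine strictMonoOn_of_deriv_pos (convex_Ici 0) hcont.continuousOn fun y hy => ?_
        rw [interior_Ici] at hy
        rw [(hasDerivAt_expNegRemainder_succ m y).deriv]
        exact (ih y hy).1
      simpa only [expNegRemainder_zero_right] using hmono self_mem_Ici hx.le hx
    · have hderiv : ∀ y : ℝ, HasDerivAt
          (fun y : ℝ => y ^ (m + 2) / (Nat.factorial (m + 2)) - expNegRemainder (m + 1) y)
          (y ^ (m + 1) / (Nat.factorial (m + 1)) - expNegRemainder m y) y := fun y => by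
        refine (((hasDerivAt_pow (m + 2) y).div_const _).congr_deriv ?_).sub
          (hasDerivAt_expNegRemainder_succ m y)
        rw [Nat.factorial_succ (m + 1), Nat.add_sub_cancel_right (m := 1) (n := m + 1)]
        push_cast
        field_simp
        ring
      have hmono := monotoneOn_of_deriv_nonneg (convex_Ici (0 : ℝ))
        (fun y _ => (hderiv y).continuousAt.continuousWithinAt)
        (fun y _ => (hderiv y).differentiableAt.differentiableWithinAt) (fun y hy => by
          rw [interior_Ici] at hy
          rw [(hderiv y).deriv]
          exact sub_nonneg.2 (ih y hy).2)
      have := hmono self_mem_Ici hx.le hx.le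
      simp only [expNegRemainder_zero_right] at this
      norm_num at this
      exact this

theorem Fn_eq_mul_expNegRemainder (n : ℕ) (x : ℝ) :
    Fn n x = 2 * (Nat.factorial (n + 1)) / x * expNegRemainder (n + 1) x := by
  rw [Fn, expNegRemainder]
  ring

theorem Fn_pos (n : ℕ) {x : ℝ} (hx : 0 < x) : 0 < Fn n x := by
  have := (expNegRemainder_bounds (n + 1) x hx).1
  rw [Fn_eq_mul_expNegRemainder]
  positivity

theorem Fn_le_two_mul_pow (n : ℕ) {x : ℝ} (hx : 0 < x) : Fn n x ≤ 2 * x ^ (n + 1) := by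
  rw [Fn_eq_mul_expNegRemainder]
  calc 2 * (Nat.factorial (n + 1)) / x * expNegRemainder (n + 1) x
      ≤ 2 * (Nat.factorial (n + 1)) / x * (x ^ (n + 2) / (Nat.factorial (n + 2))) := by
        gcongr
        exact (expNegRemainder_bounds (n + 1) x hx).2
    _ = 2 * x ^ (n + 1) / (n + 2) := by
        rw [Nat.factorial_succ (n + 1)]
        push_cast
        field_simp
        ring
    _ ≤ 2 * x ^ (n + 1) := by
        apply div_le_self (by positivity)
        have : (0 : ℝ) ≤ n := n.cast_nonneg
        linarith

theorem continuousOn_Fn (n : ℕ) : ContinuousOn (Fn n) (Ioi 0) := by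
  have hcont : Continuous (expNegRemainder (n + 1)) :=
    continuous_iff_continuousAt.2 fun y => (hasDerivAt_expNegRemainder_succ n y).continuousAt
  refine ContinuousOn.congr (f := fun x => 2 * (Nat.factorial (n + 1)) / x *
    expNegRemainder (n + 1) x) ?_ fun x _ => Fn_eq_mul_expNegRemainder n x
  exact (continuousOn_const.div continuousOn_id fun x hx => (mem_Ioi.1 hx).ne').mul
    hcont.continuousOn

/-- The time at which the solution of `φ' = Fn n φ`, `φ q₀ = φ₀` reaches the value `x`. -/
noncomputable def hittingTime (n : ℕ) (q₀ φ₀ x : ℝ) : ℝ :=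
  q₀ + ∫ φ in φ₀..x, 1 / Fn n φ

theorem hittingTime_self (n : ℕ) (q₀ φ₀ : ℝ) : hittingTime n q₀ φ₀ φ₀ = q₀ := by
  simp [hittingTime]

theorem continuousOn_one_div_Fn (n : ℕ) : ContinuousOn (fun x => 1 / Fn n x) (Ioi 0) :=
  continuousOn_const.div (continuousOn_Fn n) fun _ hx => (Fn_pos n hx).ne'

theorem intervalIntegrable_one_div_Fn (n : ℕ) {a b : ℝ} (ha : 0 < a) (hb : 0 < b) :
    IntervalIntegrable (fun x => 1 / Fn n x) volume a b :=
  ((continuousOn_one_div_Fn n).mono fun _ hx =>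
    (lt_min ha hb).trans_le hx.1).intervalIntegrable

theorem lintegral_Ioc_one_div_Fn (n : ℕ) {a b : ℝ} (ha : 0 < a) (hab : a ≤ b) :
    ∫⁻ x in Ioc a b, ENNReal.ofReal (1 / Fn n x) =
      ENNReal.ofReal (∫ x in a..b, 1 / Fn n x) := by
  rw [intervalIntegral.integral_of_le hab, ofReal_integral_eq_lintegral_ofReal]
  · exact (intervalIntegrable_iff_integrableOn_Ioc_of_le hab).1
      (intervalIntegrable_one_div_Fn n ha (ha.trans_le hab))
  · refine (ae_restrict_iff' measurableSet_Ioc).2 (ae_of_all _ fun x hx => ?_)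
    exact (one_div_pos.2 (Fn_pos n (ha.trans hx.1))).le

section HittingTime

variable {n : ℕ} {q₀ φ₀ : ℝ}

theorem hasDerivAt_hittingTime (hφ₀ : 0 < φ₀) {x : ℝ} (hx : 0 < x) :
    HasDerivAt (hittingTime n q₀ φ₀) (1 / Fn n x) x :=
  (intervalIntegral.integral_hasDerivAt_right (intervalIntegrable_one_div_Fn n hφ₀ hx)
    ((continuousOn_one_div_Fn n).stronglyMeasurableAtFilter isOpen_Ioi x hx)
    ((continuousOn_one_div_Fn n).continuousAt (Ioi_mem_nhds hx))).const_add q₀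

theorem continuousOn_hittingTime (hφ₀ : 0 < φ₀) :
    ContinuousOn (hittingTime n q₀ φ₀) (Ioi 0) :=
  fun _ hx => (hasDerivAt_hittingTime hφ₀ hx).continuousAt.continuousWithinAt

theorem strictMonoOn_hittingTime (hφ₀ : 0 < φ₀) :
    StrictMonoOn (hittingTime n q₀ φ₀) (Ioi 0) := by
  refine strictMonoOn_of_deriv_pos (convex_Ioi 0) (continuousOn_hittingTime hφ₀) fun x hx => ?_
  rw [interior_Ioi] at hx
  rw [(hasDerivAt_hittingTime hφ₀ hx).deriv]
  exact one_div_pos.2 (Fn_pos n hx)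

theorem hittingTime_le_log (hφ₀ : 0 < φ₀) {x : ℝ} (hx : 0 < x) (hxφ : x ≤ φ₀) :
    hittingTime n q₀ φ₀ x ≤ q₀ + (Real.log x - Real.log φ₀) / (2 * φ₀ ^ n) := by
  have hderiv : ∀ y : ℝ, 0 < y → HasDerivAt
      (fun y => hittingTime n q₀ φ₀ y - Real.log y / (2 * φ₀ ^ n))
      (1 / Fn n y - y⁻¹ / (2 * φ₀ ^ n)) y := fun y hy =>
    (hasDerivAt_hittingTime hφ₀ hy).sub ((Real.hasDerivAt_log hy.ne').div_const _)
  have hmono := monotoneOn_of_deriv_nonneg (convex_Ioc (0 : ℝ) φ₀)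
    (fun y hy => (hderiv y hy.1).continuousAt.continuousWithinAt)
    (fun y hy => (hderiv y (interior_subset hy).1).differentiableAt.differentiableWithinAt)
    (fun y hy => by
      have hy := interior_subset hy
      have hy0 := hy.1
      rw [(hderiv y hy0).deriv, sub_nonneg, inv_eq_one_div, div_div]
      refine one_div_le_one_div_of_le (Fn_pos n hy0) ((Fn_le_two_mul_pow n hy0).trans ?_)
      have : y ^ n ≤ φ₀ ^ n := pow_le_pow_left₀ hy0.le hy.2 n
      rw [pow_succ]
      nlinarith)
  have := hmono ⟨hx, hxφ⟩ ⟨hφ₀, le_rfl⟩ hxφ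
  simp only [hittingTime_self] at this
  rw [sub_div, ← add_sub_assoc, add_sub_right_comm]
  exact sub_le_iff_le_add.1 this

theorem exists_hittingTime_lt (hφ₀ : 0 < φ₀) (q : ℝ) :
    ∃ x, 0 < x ∧ x ≤ φ₀ ∧ hittingTime n q₀ φ₀ x < q := by
  have hlim : Tendsto (fun x => q₀ + (Real.log x - Real.log φ₀) / (2 * φ₀ ^ n))
      (nhdsWithin 0 (Ioi 0)) atBot :=
    tendsto_atBot_add_const_left _ _ ((tendsto_atBot_add_const_right _ _
      Real.tendsto_log_nhdsGT_zero).atBot_div_const (by positivity))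
  obtain ⟨x, hxq, hx⟩ :=
    ((hlim.eventually (eventually_lt_atBot q)).and (Ioc_mem_nhdsGT hφ₀)).exists
  exact ⟨x, hx.1, hx.2, (hittingTime_le_log hφ₀ hx.1 hx.2).trans_lt hxq⟩

theorem lintegral_Ioo_one_div_Fn_eq_top (hφ₀ : 0 < φ₀) :
    ∫⁻ x in Ioo 0 φ₀, ENNReal.ofReal (1 / Fn n x) = ⊤ := by
  refine ENNReal.eq_top_of_forall_nnreal_le fun r => ?_
  obtain ⟨x, hx, hxφ, hxr⟩ := exists_hittingTime_lt (q₀ := 0) hφ₀ (-r)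
  rw [hittingTime, zero_add, intervalIntegral.integral_symm] at hxr
  rw [setLIntegral_congr Ioo_ae_eq_Ioc]
  calc (r : ℝ≥0∞) = ENNReal.ofReal r := (ENNReal.ofReal_coe_nnreal).symm
    _ ≤ ENNReal.ofReal (∫ y in x..φ₀, 1 / Fn n y) := ENNReal.ofReal_le_ofReal (neg_lt_neg_iff.1 hxr).le
    _ = ∫⁻ y in Ioc x φ₀, ENNReal.ofReal (1 / Fn n y) := (lintegral_Ioc_one_div_Fn n hx hxφ).symm
    _ ≤ _ := lintegral_mono_set (Ioc_subset_Ioc_left hx.le)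

theorem coe_lt_qb_iff_exists_lt (hφ₀ : 0 < φ₀) {q : ℝ} :
    (q : EReal) < qb n q₀ φ₀ ↔ ∃ x, 0 < x ∧ q < hittingTime n q₀ φ₀ x := by
  constructor
  · intro hq
    rcases lt_or_ge q q₀ with hlt | hle
    · exact ⟨φ₀, hφ₀, by rwa [hittingTime_self]⟩
    have hL : ENNReal.ofReal (q - q₀) < ∫⁻ x in Ioi φ₀, ENNReal.ofReal (1 / Fn n x) := by
      by_contra! hcon
      refine hq.not_ge ?_
      calc qb n q₀ φ₀ ≤ (q₀ : EReal) + (ENNReal.ofReal (q - q₀) : EReal) :=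
            add_le_add_right (EReal.coe_ennreal_le_coe_ennreal_iff.2 hcon) _
        _ = q := by
            rw [EReal.coe_ennreal_ofReal, max_eq_left (sub_nonneg.2 hle), ← EReal.coe_add,
              add_sub_cancel]
    have hcover : ⋃ k : ℕ, Ioc φ₀ (φ₀ + k) = Ioi φ₀ := by
      refine Subset.antisymm (iUnion_subset fun k => Ioc_subset_Ioi_self) fun x hx => ?_
      obtain ⟨k, hk⟩ := exists_nat_ge (x - φ₀)
      exact mem_iUnion.2 ⟨k, hx, by linarith⟩
    rw [← hcover, setLIntegral_iUnion_of_directed, lt_iSup_iff] at hL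
    · obtain ⟨k, hk⟩ := hL
      have hk0 : φ₀ ≤ φ₀ + k := le_add_of_nonneg_right k.cast_nonneg
      rw [lintegral_Ioc_one_div_Fn n hφ₀ hk0] at hk
      refine ⟨φ₀ + k, hφ₀.trans_le hk0, ?_⟩
      have := (ENNReal.ofReal_lt_ofReal_iff_of_nonneg (sub_nonneg.2 hle)).1 hk
      exact sub_lt_iff_lt_add'.1 this
    · exact Monotone.directed_le fun i j hij => Ioc_subset_Ioc_right (by gcongr)
  · rintro ⟨x, hx, hqx⟩
    have hmax : hittingTime n q₀ φ₀ x ≤ hittingTime n q₀ φ₀ (max x φ₀) :=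
      (strictMonoOn_hittingTime hφ₀).monotoneOn hx (hx.trans_le (le_max_left _ _))
        (le_max_left _ _)
    have hint := lintegral_Ioc_one_div_Fn n hφ₀ (le_max_right x φ₀)
    have hle : ENNReal.ofReal (∫ y in φ₀..max x φ₀, 1 / Fn n y) ≤
        ∫⁻ y in Ioi φ₀, ENNReal.ofReal (1 / Fn n y) :=
      hint ▸ lintegral_mono_set Ioc_subset_Ioi_self
    calc (q : EReal) < (hittingTime n q₀ φ₀ (max x φ₀) : ℝ) :=
          EReal.coe_lt_coe_iff.2 (hqx.trans_le hmax)
      _ ≤ (q₀ : EReal) + (ENNReal.ofReal (∫ y in φ₀..max x φ₀, 1 / Fn n y) : EReal) := by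
          rw [EReal.coe_ennreal_ofReal, ← EReal.coe_add, EReal.coe_le_coe_iff, hittingTime]
          gcongr
          exact le_max_left _ _
      _ ≤ qb n q₀ φ₀ := add_le_add_right (EReal.coe_ennreal_le_coe_ennreal_iff.2 hle) _

theorem coe_hittingTime_lt_qb (hφ₀ : 0 < φ₀) {x : ℝ} (hx : 0 < x) :
    (hittingTime n q₀ φ₀ x : EReal) < qb n q₀ φ₀ :=
  (coe_lt_qb_iff_exists_lt hφ₀).2 ⟨x + 1, by linarith,
    strictMonoOn_hittingTime hφ₀ hx (mem_Ioi.2 (by linarith)) (lt_add_one x)⟩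

theorem image_hittingTime (hφ₀ : 0 < φ₀) :
    hittingTime n q₀ φ₀ '' Ioi 0 = {q : ℝ | (q : EReal) < qb n q₀ φ₀} := by
  refine Subset.antisymm (image_subset_iff.2 fun x hx => coe_hittingTime_lt_qb hφ₀ hx) ?_
  intro q hq
  obtain ⟨y, hy, hqy⟩ := (coe_lt_qb_iff_exists_lt hφ₀).1 hq
  obtain ⟨x, hx, -, hxq⟩ := exists_hittingTime_lt (q₀ := q₀) hφ₀ q
  exact isPreconnected_Ioi.intermediate_value hx hy (continuousOn_hittingTime hφ₀)
    ⟨hxq.le, hqy.le⟩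

theorem hittingTime_comp_solution {g : ℝ → ℝ} (hφ₀ : 0 < φ₀) (hg₀ : g q₀ = φ₀)
    (hg : ∀ q : ℝ, (q : EReal) < qb n q₀ φ₀ → 0 < g q ∧ HasDerivAt g (Fn n (g q)) q)
    {q : ℝ} (hq : (q : EReal) < qb n q₀ φ₀) : hittingTime n q₀ φ₀ (g q) = q := by
  have hopen : IsOpen {q : ℝ | (q : EReal) < qb n q₀ φ₀} :=
    isOpen_lt continuous_coe_real_ereal continuous_const
  have hconn : IsPreconnected {q : ℝ | (q : EReal) < qb n q₀ φ₀} :=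
    OrdConnected.isPreconnected ⟨fun _ _ _ hb _ hc =>
      (EReal.coe_le_coe_iff.2 hc.2).trans_lt hb⟩
  have hderiv : ∀ p : ℝ, (p : EReal) < qb n q₀ φ₀ →
      HasDerivAt (fun p => hittingTime n q₀ φ₀ (g p)) 1 p := fun p hp => by
    have := (hasDerivAt_hittingTime (n := n) (q₀ := q₀) hφ₀ (hg p hp).1).comp p (hg p hp).2
    rwa [one_div_mul_cancel (Fn_pos n (hg p hp).1).ne'] at this
  refine hopen.eqOn_of_deriv_eq hconn
    (fun p hp => (hderiv p hp).differentiableAt.differentiableWithinAt)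
    differentiableOn_id (fun p hp => ?_) (x := q₀) ?_ ?_ hq
  · rw [(hderiv p hp).deriv, deriv_id]
  · have := coe_hittingTime_lt_qb (n := n) (q₀ := q₀) hφ₀ hφ₀
    rwa [hittingTime_self] at this
  · simp only [hg₀, hittingTime_self, id]

end HittingTime

/-- Let `n ≥ 1`, `q₀ ∈ ℝ` and `φ₀ > 0`.  Then `∫_{0}^{φ₀} dφ/Fn n φ = +∞`, and, with
`q_b = q₀ + ∫_{φ₀}^{∞} dφ/Fn n φ ∈ (q₀, +∞]`, there is a (unique on `(−∞, q_b)`)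
differentiable `φ : (−∞, q_b) → (0,∞)` with `φ(q₀) = φ₀` and `φ' = Fn n ∘ φ`; moreover `φ`
is strictly increasing, `φ(q) → 0` as `q → −∞`, and `φ(q) → ∞` as `q → q_b`. -/
theorem exists_unique_soliton_solution (n : ℕ) (hn : 1 ≤ n) (q₀ φ₀ : ℝ) (hφ₀ : 0 < φ₀) :
    (∫⁻ φ in Set.Ioo (0 : ℝ) φ₀, ENNReal.ofReal (1 / Fn n φ)) = ⊤ ∧
    (q₀ : EReal) < qb n q₀ φ₀ ∧
    ∃ f : ℝ → ℝ,
      f q₀ = φ₀ ∧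
      (∀ q : ℝ, (q : EReal) < qb n q₀ φ₀ → 0 < f q ∧ HasDerivAt f (Fn n (f q)) q) ∧
      (∀ g : ℝ → ℝ, g q₀ = φ₀ →
        (∀ q : ℝ, (q : EReal) < qb n q₀ φ₀ → 0 < g q ∧ HasDerivAt g (Fn n (g q)) q) →
        ∀ q : ℝ, (q : EReal) < qb n q₀ φ₀ → g q = f q) ∧
      StrictMonoOn f {q : ℝ | (q : EReal) < qb n q₀ φ₀} ∧
      Tendsto f atBot (nhds 0) ∧
      (qb n q₀ φ₀ = ⊤ → Tendsto f atTop atTop) ∧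
      (∀ r : ℝ, qb n q₀ φ₀ = (r : EReal) → Tendsto f (nhdsWithin r (Set.Iio r)) atTop) := by
  have hmono := strictMonoOn_hittingTime (n := n) (q₀ := q₀) hφ₀
  have himage := image_hittingTime (n := n) (q₀ := q₀) hφ₀
  have hlt : ∀ x, 0 < x → (hittingTime n q₀ φ₀ x : EReal) < qb n q₀ φ₀ :=
    fun x hx => coe_hittingTime_lt_qb hφ₀ hx
  set S : Set ℝ := {q : ℝ | (q : EReal) < qb n q₀ φ₀} with hS
  have hopen : IsOpen S := isOpen_lt continuous_coe_real_ereal continuous_const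
  let f : ℝ → ℝ := Function.invFunOn (hittingTime n q₀ φ₀) (Ioi 0)
  have hfpos : ∀ q ∈ S, 0 < f q := fun q hq => Function.invFunOn_mem (by rwa [← himage] at hq)
  have hHf : ∀ q ∈ S, hittingTime n q₀ φ₀ (f q) = q :=
    fun q hq => Function.invFunOn_eq (by rwa [← himage] at hq)
  have hfH : ∀ x, 0 < x → f (hittingTime n q₀ φ₀ x) = x :=
    fun x hx => hmono.injOn (hfpos _ (hlt x hx)) hx (hHf _ (hlt x hx))
  have hfmono : StrictMonoOn f S := fun p hp q hq hpq => by
    rwa [← hmono.lt_iff_lt (hfpos p hp) (hfpos q hq), hHf p hp, hHf q hq]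
  have hfderiv : ∀ q ∈ S, HasDerivAt f (Fn n (f q)) q := fun q hq => by
    have hfcont : ContinuousAt f q := by
      refine hfmono.continuousAt_of_image_mem_nhds (hopen.mem_nhds hq)
        (mem_of_superset (Ioi_mem_nhds (hfpos q hq)) fun x hx => ?_)
      exact ⟨_, hlt x hx, hfH x hx⟩
    have hF := Fn_pos n (hfpos q hq)
    have := HasDerivAt.of_local_left_inverse hfcont
      (hasDerivAt_hittingTime (q₀ := q₀) hφ₀ (hfpos q hq)) (one_div_pos.2 hF).ne'
      (mem_of_superset (hopen.mem_nhds hq) hHf)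
    rwa [one_div, inv_inv] at this
  have hatTop : ∀ M : ℝ, ∃ p : ℝ, (p : EReal) < qb n q₀ φ₀ ∧ ∀ q ∈ S, p < q → M ≤ f q := by
    intro M
    have hM : 0 < max M 1 := lt_max_of_lt_right one_pos
    refine ⟨hittingTime n q₀ φ₀ (max M 1), hlt _ hM, fun q hq hpq => ?_⟩
    have := hfmono (hlt _ hM) hq hpq
    rw [hfH _ hM] at this
    exact (le_max_left _ _).trans this.le
  have hq₀ : q₀ ∈ S := by
    have := hlt φ₀ hφ₀
    rwa [hittingTime_self] at this
  refine ⟨lintegral_Ioo_one_div_Fn_eq_top hφ₀, hq₀, f, ?_, fun q hq =>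
    ⟨hfpos q hq, hfderiv q hq⟩, fun g hg₀ hg q hq => ?_, hfmono, ?_, fun htop => ?_, fun r hr => ?_⟩
  · simpa only [hittingTime_self] using hfH φ₀ hφ₀
  · have := hfH (g q) (hg q hq).1
    rwa [hittingTime_comp_solution hφ₀ hg₀ hg hq, eq_comm] at this
  · have hbelow : ∀ ε : ℝ, 0 < ε → ∀ᶠ q in atBot, q ∈ S ∧ f q < ε := fun ε hε => by
      filter_upwards [eventually_lt_atBot (hittingTime n q₀ φ₀ ε)] with q hq
      have hqS : q ∈ S := (EReal.coe_lt_coe_iff.2 hq).trans (hlt ε hε)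
      have := hfmono hqS (hlt ε hε) hq
      exact ⟨hqS, by rwa [hfH ε hε] at this⟩
    refine tendsto_order.2 ⟨fun a ha => ?_, fun a ha => (hbelow a ha).mono fun _ h => h.2⟩
    exact (hbelow 1 one_pos).mono fun q h => ha.trans (hfpos q h.1)
  · refine tendsto_atTop.2 fun M => ?_
    obtain ⟨p, -, hp⟩ := hatTop M
    filter_upwards [eventually_gt_atTop p] with q hq
    exact hp q (by rw [hS, mem_ofPred_eq, htop]; exact EReal.coe_lt_top q) hq
  · refine tendsto_atTop.2 fun M => ?_
    obtain ⟨p, hpr, hp⟩ := hatTop M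
    rw [hr, EReal.coe_lt_coe_iff] at hpr
    filter_upwards [Ioo_mem_nhdsLT hpr] with q hq
    exact hp q (by rw [hS, mem_ofPred_eq, hr]; exact EReal.coe_lt_coe_iff.2 hq.2) hq.1
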